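/- Let R be a unital ring and let (P,Q,ψ) be a unital R-system satisfying Condition (FS'). Let (S,T,σ,B) be a semi-full graded covariant representation of (P,Q,ψ) such that the ideal I^(k) of B₀ has a multiplicative identity element for every k ≥ 0. Then B is epsilon-strongly ℤ-graded: for every i ∈ ℤ there exist ε_i ∈ B_i B_{-i} and ε'_i ∈ B_{-i} B_i such that ε_i x = x = x ε'_i for all x ∈ B_i. -/

import Mathlib

set_option maxHeartbeats 800000

/-- For additive subgroups `X Y` of a (possibly non-unital) ring `B`, `sMul X Y` is the
additive span of the set of products `x * y` with `x ∈ X`, `y ∈ Y`. -/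
def sMul {B : Type*} [NonUnitalRing B] (X Y : AddSubgroup B) : AddSubgroup B :=
  AddSubgroup.closure {z : B | ∃ x ∈ X, ∃ y ∈ Y, z = x * y}

/-- The `n`-fold product `X ⋯ X` of an additive subgroup of a ring, defined for `n ≥ 1`
(the value at `0` is junk). -/
def sPow {B : Type*} [NonUnitalRing B] (X : AddSubgroup B) : ℕ → AddSubgroup B
  | 0 => ⊥
  | 1 => X
  | n + 2 => sMul (sPow X (n + 1)) X

/-- A ℤ-grading of a (possibly non-unital) ring `B`: an internal direct sum decomposition
into additive subgroups with `B_i B_j ⊆ B_{i+j}`. -/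
structure ZGrading (B : Type*) [NonUnitalRing B] where
  comp : ℤ → AddSubgroup B
  isInternal : DirectSum.IsInternal comp
  mul_mem : ∀ {i j : ℤ} {x y : B}, x ∈ comp i → y ∈ comp j → x * y ∈ comp (i + j)

/-- A bimodule action of a (possibly non-unital) ring `R` on an abelian group `M`. -/
structure BimodAction (R M : Type*) [NonUnitalRing R] [AddCommGroup M] where
  lsmul : R → M → M
  rsmul : M → R → M
  lsmul_add : ∀ (r : R) (m m' : M), lsmul r (m + m') = lsmul r m + lsmul r m'
  add_lsmul : ∀ (r r' : R) (m : M), lsmul (r + r') m = lsmul r m + lsmul r' m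
  rsmul_add : ∀ (m m' : M) (r : R), rsmul (m + m') r = rsmul m r + rsmul m' r
  add_rsmul : ∀ (m : M) (r r' : R), rsmul m (r + r') = rsmul m r + rsmul m r'
  mul_lsmul : ∀ (r r' : R) (m : M), lsmul (r * r') m = lsmul r (lsmul r' m)
  rsmul_mul : ∀ (m : M) (r r' : R), rsmul m (r * r') = rsmul (rsmul m r) r'
  lsmul_rsmul : ∀ (r : R) (m : M) (r' : R), rsmul (lsmul r m) r' = lsmul r (rsmul m r')

/-- An `R`-system `(P, Q, ψ)`: `P` and `Q` are `R`-bimodules and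
`ψ : P × Q → R` is biadditive and `R`-balanced/bilinear. -/
structure RSystem (R P Q : Type*) [NonUnitalRing R] [AddCommGroup P] [AddCommGroup Q] where
  actP : BimodAction R P
  actQ : BimodAction R Q
  psi : P → Q → R
  psi_add_left : ∀ (p p' : P) (q : Q), psi (p + p') q = psi p q + psi p' q
  psi_add_right : ∀ (p : P) (q q' : Q), psi p (q + q') = psi p q + psi p q'
  psi_lsmul : ∀ (r : R) (p : P) (q : Q), psi (actP.lsmul r p) q = r * psi p q
  psi_rsmul : ∀ (p : P) (q : Q) (r : R), psi p (actQ.rsmul q r) = psi p q * r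
  psi_mid : ∀ (p : P) (r : R) (q : Q), psi (actP.rsmul p r) q = psi p (actQ.lsmul r q)

/-- The `R`-system is unital: the bimodules `P` and `Q` are unital. -/
def RSystem.IsUnital {R P Q : Type*} [Ring R] [AddCommGroup P] [AddCommGroup Q]
    (sys : RSystem R P Q) : Prop :=
  (∀ p, sys.actP.lsmul 1 p = p) ∧ (∀ p, sys.actP.rsmul p 1 = p) ∧
    (∀ q, sys.actQ.lsmul 1 q = q) ∧ (∀ q, sys.actQ.rsmul q 1 = q)

/-- An s-unital (possibly non-unital) ring. -/
def IsSUnitalRing (R : Type*) [NonUnitalRing R] : Prop :=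
  ∀ r : R, (∃ u, u * r = r) ∧ (∃ v, r * v = r)

/-- The `R`-system is s-unital: `R` is s-unital and the bimodules `P`, `Q` are s-unital. -/
def RSystem.IsSUnital {R P Q : Type*} [NonUnitalRing R] [AddCommGroup P] [AddCommGroup Q]
    (sys : RSystem R P Q) : Prop :=
  IsSUnitalRing R ∧
    (∀ p : P, (∃ r, sys.actP.lsmul r p = p) ∧ (∃ r, sys.actP.rsmul p r = p)) ∧
    (∀ q : Q, (∃ r, sys.actQ.lsmul r q = q) ∧ (∃ r, sys.actQ.rsmul q r = q))

/-- A covariant representation `(S, T, σ, B)` of an `R`-system `(P, Q, ψ)`. -/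
structure CovRep {R P Q : Type*} [NonUnitalRing R] [AddCommGroup P] [AddCommGroup Q]
    (sys : RSystem R P Q) (B : Type*) [NonUnitalRing B] where
  S : P → B
  T : Q → B
  σ : R → B
  S_add : ∀ p p', S (p + p') = S p + S p'
  T_add : ∀ q q', T (q + q') = T q + T q'
  σ_add : ∀ r r', σ (r + r') = σ r + σ r'
  σ_mul : ∀ r r', σ (r * r') = σ r * σ r'
  S_rsmul : ∀ p r, S (sys.actP.rsmul p r) = S p * σ r
  S_lsmul : ∀ r p, S (sys.actP.lsmul r p) = σ r * S p
  T_rsmul : ∀ q r, T (sys.actQ.rsmul q r) = T q * σ r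
  T_lsmul : ∀ r q, T (sys.actQ.lsmul r q) = σ r * T q
  σ_psi : ∀ p q, σ (sys.psi p q) = S p * T q

/-- A graded covariant representation: a surjective covariant representation together with a
ℤ-grading of `B` such that `σ(R) ⊆ B₀`, `T(Q) ⊆ B₁` and `S(P) ⊆ B₋₁`. -/
structure GradedCovRep {R P Q : Type*} [NonUnitalRing R] [AddCommGroup P] [AddCommGroup Q]
    (sys : RSystem R P Q) (B : Type*) [NonUnitalRing B] extends CovRep sys B where
  grading : ZGrading B
  surjective : NonUnitalSubring.closure (Set.range σ ∪ Set.range S ∪ Set.range T) = ⊤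
  σ_mem : ∀ r, σ r ∈ grading.comp 0
  T_mem : ∀ q, T q ∈ grading.comp 1
  S_mem : ∀ p, S p ∈ grading.comp (-1)

/-- The operator `θ_{q,p} : Q → Q`, `x ↦ q · ψ(p, x)`. -/
def theta {R P Q : Type*} [NonUnitalRing R] [AddCommGroup P] [AddCommGroup Q]
    (sys : RSystem R P Q) (q : Q) (p : P) : Q → Q :=
  fun x => sys.actQ.rsmul q (sys.psi p x)

/-- The operator `θ_{p,q} : P → P`, `y ↦ ψ(y, q) · p`. -/
def thetaOp {R P Q : Type*} [NonUnitalRing R] [AddCommGroup P] [AddCommGroup Q]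
    (sys : RSystem R P Q) (p : P) (q : Q) : P → P :=
  fun y => sys.actP.lsmul (sys.psi y q) p

/-- `F_P(Q)`: the additive span of the operators `θ_{q,p}`. -/
def FPQ {R P Q : Type*} [NonUnitalRing R] [AddCommGroup P] [AddCommGroup Q]
    (sys : RSystem R P Q) : AddSubgroup (Q → Q) :=
  AddSubgroup.closure {f | ∃ q p, f = theta sys q p}

/-- `F_Q(P)`: the additive span of the operators `θ_{p,q}`. -/
def FQP {R P Q : Type*} [NonUnitalRing R] [AddCommGroup P] [AddCommGroup Q]
    (sys : RSystem R P Q) : AddSubgroup (P → P) :=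
  AddSubgroup.closure {f | ∃ p q, f = thetaOp sys p q}

/-- Condition (FS). -/
def CondFS {R P Q : Type*} [NonUnitalRing R] [AddCommGroup P] [AddCommGroup Q]
    (sys : RSystem R P Q) : Prop :=
  ∀ (qs : List Q) (ps : List P), ∃ Θ ∈ FPQ sys, ∃ Φ ∈ FQP sys,
    (∀ q ∈ qs, Θ q = q) ∧ (∀ p ∈ ps, Φ p = p)

/-- Condition (FS'): `id_Q ∈ F_P(Q)` and `id_P ∈ F_Q(P)`. -/
def CondFS' {R P Q : Type*} [NonUnitalRing R] [AddCommGroup P] [AddCommGroup Q]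
    (sys : RSystem R P Q) : Prop :=
  (id : Q → Q) ∈ FPQ sys ∧ (id : P → P) ∈ FQP sys

/-- `mulCont b [x₁,…,xₙ] = b * x₁ * ⋯ * xₙ` (left-associated product in a possibly
non-unital ring). -/
def mulCont {B : Type*} [NonUnitalRing B] : B → List B → B
  | b, [] => b
  | b, x :: xs => mulCont (b * x) xs

/-- The generating set of the ideal `I^(k)` of `B₀`: for `k ≥ 1` the set of products
`S(p₁)⋯S(pₖ) T(q₁)⋯T(qₖ)`, and for `k = 0` the set `{σ(r r') : r, r' ∈ R}`. -/
def genSet {R P Q B : Type*} [NonUnitalRing R] [AddCommGroup P] [AddCommGroup Q]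
    [NonUnitalRing B] {sys : RSystem R P Q} (rep : CovRep sys B) : ℕ → Set B
  | 0 => {b | ∃ r r' : R, b = rep.σ (r * r')}
  | k + 1 => {b | ∃ (p : P) (ps : List P) (q : Q) (qs : List Q),
      ps.length = k ∧ qs.length = k ∧
      b = mulCont (rep.S p) (ps.map rep.S) * mulCont (rep.T q) (qs.map rep.T)}

/-- The two-sided ideal of `B₀` generated by a subset `X ⊆ B₀`. -/
def idealGen {B : Type*} [NonUnitalRing B] (B0 : AddSubgroup B) (X : Set B) : AddSubgroup B :=
  sInf {I : AddSubgroup B | X ⊆ I ∧ I ≤ B0 ∧ ∀ a ∈ B0, ∀ x ∈ I, a * x ∈ I ∧ x * a ∈ I}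

/-- The ideal `I^(k)` of `B₀` associated to a covariant representation. -/
def idealI {R P Q B : Type*} [NonUnitalRing R] [AddCommGroup P] [AddCommGroup Q]
    [NonUnitalRing B] {sys : RSystem R P Q} (rep : GradedCovRep sys B) (k : ℕ) :
    AddSubgroup B :=
  idealGen (rep.grading.comp 0) (genSet rep.toCovRep k)

/-- A graded covariant representation is semi-full if `B_{-k} B_k = I^(k)` for every `k ≥ 0`. -/
def SemiFull {R P Q B : Type*} [NonUnitalRing R] [AddCommGroup P] [AddCommGroup Q]
    [NonUnitalRing B] {sys : RSystem R P Q} (rep : GradedCovRep sys B) : Prop :=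
  ∀ k : ℕ, sMul (rep.grading.comp (-(k : ℤ))) (rep.grading.comp (k : ℤ)) = idealI rep k

/-- If `A i ≤ C i` for an independent family `C` in a modular lattice and the `A i` span
everything, then `A = C`. -/
theorem iSupIndep.le_of_le_of_iSup_eq_top {ι α : Type*} [CompleteLattice α] [IsModularLattice α]
    {A C : ι → α} (hC : iSupIndep C) (hAC : ∀ i, A i ≤ C i) (hA : ⨆ i, A i = ⊤) (i : ι) :
    C i ≤ A i := by
  have htop : A i ⊔ ⨆ (j) (_ : j ≠ i), A j = ⊤ := by
    rw [eq_top_iff, ← hA]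
    refine iSup_le fun j => ?_
    by_cases h : j = i
    · exact h ▸ le_sup_left
    · exact le_sup_of_le_right (le_iSup₂_of_le j h le_rfl)
  have hbot : (⨆ (j) (_ : j ≠ i), A j) ⊓ C i = ⊥ := by
    rw [eq_bot_iff, inf_comm]
    exact (inf_le_inf_left _ (iSup₂_mono fun j _ => hAC j)).trans (hC i).le_bot
  have h := sup_inf_assoc_of_le (⨆ (j) (_ : j ≠ i), A j) (hAC i)
  rw [htop, hbot, top_inf_eq, sup_bot_eq] at h
  exact h.le

section sMul

variable {B : Type*} [NonUnitalRing B]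

theorem mul_mem_sMul {X Y : AddSubgroup B} {x y : B} (hx : x ∈ X) (hy : y ∈ Y) :
    x * y ∈ sMul X Y :=
  AddSubgroup.subset_closure ⟨x, hx, y, hy, rfl⟩

theorem mul_mul_mem_sMul {X Y X' Y' : AddSubgroup B} {a b e : B} (ha : ∀ x ∈ X, a * x ∈ X')
    (hb : ∀ y ∈ Y, y * b ∈ Y') (he : e ∈ sMul X Y) : a * e * b ∈ sMul X' Y' := by
  induction he using AddSubgroup.closure_induction with
  | mem e he =>
    obtain ⟨x, hx, y, hy, rfl⟩ := he
    rw [← mul_assoc, mul_assoc]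
    exact mul_mem_sMul (ha x hx) (hb y hy)
  | zero => simp
  | add e f _ _ he hf => rw [mul_add, add_mul]; exact add_mem he hf
  | neg e _ he => rw [mul_neg, neg_mul]; exact neg_mem he

/-- A right identity of `Y * x` is a right identity of `x` as soon as `x = e * x` for some
`e ∈ X * Y`. -/
theorem mul_eq_self_of_left_unit {X Y : AddSubgroup B} {e x u : B} (he : e ∈ sMul X Y)
    (hex : e * x = x) (hu : ∀ y ∈ Y, y * x * u = y * x) : x * u = x := by
  suffices h : e * x * u = e * x by rwa [hex] at h
  clear hex
  induction he using AddSubgroup.closure_induction with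
  | mem e he =>
    obtain ⟨a, -, y, hy, rfl⟩ := he
    rw [mul_assoc a, mul_assoc a, hu y hy]
  | zero => simp
  | add e f _ _ he hf => rw [add_mul, add_mul, he, hf]
  | neg e _ he => rw [neg_mul, neg_mul, he]

/-- A left identity of `x * X` is a left identity of `x` as soon as `x = x * e` for some
`e ∈ X * Y`. -/
theorem mul_eq_self_of_right_unit {X Y : AddSubgroup B} {e x u : B} (he : e ∈ sMul X Y)
    (hex : x * e = x) (hu : ∀ a ∈ X, u * (x * a) = x * a) : u * x = x := by
  suffices h : u * (x * e) = x * e by rwa [hex] at h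
  clear hex
  induction he using AddSubgroup.closure_induction with
  | mem e he =>
    obtain ⟨a, ha, y, -, rfl⟩ := he
    rw [← mul_assoc x, ← mul_assoc u, hu a ha]
  | zero => simp
  | add e f _ _ he hf => rw [mul_add, mul_add, he, hf]
  | neg e _ he => rw [mul_neg, mul_neg, he]

theorem ZGrading.mul_mem' (G : ZGrading B) {i j k : ℤ} {x y : B} (hx : x ∈ G.comp i)
    (hy : y ∈ G.comp j) (h : i + j = k) : x * y ∈ G.comp k :=
  h ▸ G.mul_mem hx hy

end sMul

section Representation

variable {R P Q B : Type*} [Ring R] [AddCommGroup P] [AddCommGroup Q] [NonUnitalRing B]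
  {sys : RSystem R P Q}

/-- `rep.IsMonomial n m b` says that `b` has the form
`T(q₁) ⋯ T(qₙ) σ(r) S(p₁) ⋯ S(pₘ)`. -/
inductive CovRep.IsMonomial (rep : CovRep sys B) : ℕ → ℕ → B → Prop
  | sigma (r : R) : rep.IsMonomial 0 0 (rep.σ r)
  | mul_S {m : ℕ} {b : B} (p : P) : rep.IsMonomial 0 m b → rep.IsMonomial 0 (m + 1) (b * rep.S p)
  | T_mul {n m : ℕ} {b : B} (q : Q) :
      rep.IsMonomial n m b → rep.IsMonomial (n + 1) m (rep.T q * b)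

namespace CovRep.IsMonomial

variable {rep : CovRep sys B} {n m : ℕ} {b : B}

theorem mul_sigma (hb : rep.IsMonomial n m b) (r : R) : rep.IsMonomial n m (b * rep.σ r) := by
  induction hb with
  | sigma r' => rw [← rep.σ_mul]; exact sigma _
  | mul_S p hb _ => rw [mul_assoc, ← rep.S_rsmul]; exact mul_S _ hb
  | T_mul q _ ih => rw [mul_assoc]; exact T_mul q ih

theorem mul_S' (hb : rep.IsMonomial n m b) (p : P) :
    rep.IsMonomial n (m + 1) (b * rep.S p) := by
  induction hb with
  | sigma r => exact mul_S p (sigma r)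
  | mul_S p' hb _ => exact mul_S p (mul_S p' hb)
  | T_mul q _ ih => rw [mul_assoc]; exact T_mul q ih

theorem exists_mul_T (hu : sys.IsUnital) (hb : rep.IsMonomial n m b) (q : Q) :
    ∃ n' m', rep.IsMonomial n' m' (b * rep.T q) := by
  induction hb with
  | sigma r =>
    refine ⟨1, 0, ?_⟩
    rw [← rep.T_lsmul, ← hu.2.2.2 (sys.actQ.lsmul r q), rep.T_rsmul]
    exact T_mul _ (sigma 1)
  | mul_S p hb _ =>
    rw [mul_assoc, ← rep.σ_psi]
    exact ⟨_, _, hb.mul_sigma _⟩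
  | T_mul q' _ ih =>
    obtain ⟨n', m', h⟩ := ih
    exact ⟨n' + 1, m', by rw [mul_assoc]; exact T_mul q' h⟩

theorem mem_comp {rep : GradedCovRep sys B} (hb : rep.toCovRep.IsMonomial n m b) :
    b ∈ rep.grading.comp ((n : ℤ) - m) := by
  induction hb with
  | sigma r => simpa using rep.σ_mem r
  | mul_S p _ ih => exact rep.grading.mul_mem' ih (rep.S_mem p) (by push_cast; ring)
  | T_mul q _ ih => exact rep.grading.mul_mem' (rep.T_mem q) ih (by push_cast; ring)

theorem exists_eq_T_mul (hb : rep.IsMonomial (n + 1) m b) :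
    ∃ q c, rep.IsMonomial n m c ∧ b = rep.T q * c := by
  cases hb with
  | T_mul q h => exact ⟨q, _, h, rfl⟩

theorem exists_eq_mul_S {k : ℕ} (hb : rep.IsMonomial n k b) (hk : k = m + 1) :
    ∃ p c, rep.IsMonomial n m c ∧ b = c * rep.S p := by
  induction hb with
  | sigma r => omega
  | mul_S p h _ =>
    obtain rfl := Nat.succ_injective hk
    exact ⟨p, _, h, rfl⟩
  | T_mul q _ ih =>
    obtain ⟨p, c, hc, rfl⟩ := ih hk
    exact ⟨p, _, T_mul q hc, (mul_assoc _ _ _).symm⟩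

end CovRep.IsMonomial

namespace CovRep

variable (rep : CovRep sys B)

theorem T_zero : rep.T 0 = 0 := by simpa using rep.T_add 0 0

theorem S_zero : rep.S 0 = 0 := by simpa using rep.S_add 0 0

theorem T_neg (q : Q) : rep.T (-q) = -rep.T q := by
  rw [eq_neg_iff_add_eq_zero, ← rep.T_add, neg_add_cancel, rep.T_zero]

theorem S_neg (p : P) : rep.S (-p) = -rep.S p := by
  rw [eq_neg_iff_add_eq_zero, ← rep.S_add, neg_add_cancel, rep.S_zero]

end CovRep

namespace GradedCovRep

variable (rep : GradedCovRep sys B)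

theorem sigma_one_mul (hu : sys.IsUnital) (x : B) : rep.σ 1 * x = x := by
  have hx : x ∈ NonUnitalSubring.closure
      (Set.range rep.σ ∪ Set.range rep.S ∪ Set.range rep.T) := by
    rw [rep.surjective]; trivial
  induction hx using NonUnitalSubring.closure_induction with
  | mem x hx =>
    rcases hx with (⟨r, rfl⟩ | ⟨p, rfl⟩) | ⟨q, rfl⟩
    · rw [← rep.σ_mul, one_mul]
    · rw [← rep.S_lsmul, hu.1]
    · rw [← rep.T_lsmul, hu.2.2.1]
  | zero => simp
  | add x y _ _ hx hy => rw [mul_add, hx, hy]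
  | neg x _ hx => rw [mul_neg, hx]
  | mul x y _ _ hx _ => rw [← mul_assoc, hx]

theorem mul_sigma_one (hu : sys.IsUnital) (x : B) : x * rep.σ 1 = x := by
  have hx : x ∈ NonUnitalSubring.closure
      (Set.range rep.σ ∪ Set.range rep.S ∪ Set.range rep.T) := by
    rw [rep.surjective]; trivial
  induction hx using NonUnitalSubring.closure_induction with
  | mem x hx =>
    rcases hx with (⟨r, rfl⟩ | ⟨p, rfl⟩) | ⟨q, rfl⟩
    · rw [← rep.σ_mul, mul_one]
    · rw [← rep.S_rsmul, hu.2.1]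
    · rw [← rep.T_rsmul, hu.2.2.2]
  | zero => simp
  | add x y _ _ hx hy => rw [add_mul, hx, hy]
  | neg x _ hx => rw [neg_mul, hx]
  | mul x y _ _ _ hy => rw [mul_assoc, hy]

theorem closure_isMonomial_eq_top (hu : sys.IsUnital) :
    AddSubgroup.closure {b | ∃ n m, rep.toCovRep.IsMonomial n m b} = ⊤ := by
  set M := AddSubgroup.closure {b | ∃ n m, rep.toCovRep.IsMonomial n m b}
  have key : ∀ x : B, ∀ y ∈ M, y * x ∈ M := by
    intro x
    have hx : x ∈ NonUnitalSubring.closure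
        (Set.range rep.σ ∪ Set.range rep.S ∪ Set.range rep.T) := by
      rw [rep.surjective]; trivial
    induction hx using NonUnitalSubring.closure_induction with
    | mem x hx =>
      intro y hy
      induction hy using AddSubgroup.closure_induction with
      | mem y hy =>
        obtain ⟨n, m, hy⟩ := hy
        refine AddSubgroup.subset_closure ?_
        rcases hx with (⟨r, rfl⟩ | ⟨p, rfl⟩) | ⟨q, rfl⟩
        · exact ⟨n, m, hy.mul_sigma r⟩
        · exact ⟨n, m + 1, hy.mul_S' p⟩
        · exact hy.exists_mul_T hu q
      | zero => simp
      | add y z _ _ hy hz => rw [add_mul]; exact add_mem hy hz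
      | neg y _ hy => rw [neg_mul]; exact neg_mem hy
    | zero => simp
    | add x x' _ _ hx hx' => intro y hy; rw [mul_add]; exact add_mem (hx y hy) (hx' y hy)
    | neg x _ hx => intro y hy; rw [mul_neg]; exact neg_mem (hx y hy)
    | mul x x' _ _ hx hx' => intro y hy; rw [← mul_assoc]; exact hx' _ (hx y hy)
  refine eq_top_iff.mpr fun x _ => ?_
  rw [← rep.sigma_one_mul hu x]
  exact key x _ (AddSubgroup.subset_closure ⟨0, 0, .sigma 1⟩)

/-- Each homogeneous component is spanned by the monomials of the corresponding degree. -/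
theorem comp_le_closure_isMonomial (hu : sys.IsUnital) (i : ℤ) :
    rep.grading.comp i ≤
      AddSubgroup.closure {b | ∃ n m : ℕ, (n : ℤ) - m = i ∧ rep.toCovRep.IsMonomial n m b} := by
  refine iSupIndep.le_of_le_of_iSup_eq_top rep.grading.isInternal.addSubgroup_iSupIndep
    (A := fun i => AddSubgroup.closure
      {b | ∃ n m : ℕ, (n : ℤ) - m = i ∧ rep.toCovRep.IsMonomial n m b}) (fun i => ?_) ?_ i
  · rw [AddSubgroup.closure_le]
    rintro b ⟨n, m, rfl, hb⟩
    exact hb.mem_comp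
  · rw [eq_top_iff, ← rep.closure_isMonomial_eq_top hu, AddSubgroup.closure_le]
    rintro b ⟨n, m, hb⟩
    exact AddSubgroup.mem_iSup_of_mem ((n : ℤ) - m)
      (AddSubgroup.subset_closure ⟨n, m, rfl, hb⟩)

theorem comp_succ_le (hu : sys.IsUnital) (k : ℕ) :
    rep.grading.comp ((k + 1 : ℕ) : ℤ) ≤
      AddSubgroup.closure {b | ∃ q, ∃ y ∈ rep.grading.comp k, b = rep.T q * y} := by
  refine (rep.comp_le_closure_isMonomial hu _).trans (AddSubgroup.closure_mono ?_)
  rintro b ⟨n, m, h, hb⟩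
  obtain ⟨n, rfl⟩ : ∃ n', n = n' + 1 := ⟨n - 1, by omega⟩
  obtain ⟨q, c, hc, rfl⟩ := hb.exists_eq_T_mul
  have hnm : (n : ℤ) - m = k := by push_cast at h; linarith
  exact ⟨q, c, hnm ▸ hc.mem_comp, rfl⟩

theorem comp_neg_succ_le (hu : sys.IsUnital) (k : ℕ) :
    rep.grading.comp (-((k + 1 : ℕ) : ℤ)) ≤
      AddSubgroup.closure {b | ∃ p, ∃ y ∈ rep.grading.comp (-(k : ℤ)), b = y * rep.S p} := by
  refine (rep.comp_le_closure_isMonomial hu _).trans (AddSubgroup.closure_mono ?_)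
  rintro b ⟨n, m, h, hb⟩
  obtain ⟨m, rfl⟩ : ∃ m', m = m' + 1 := ⟨m - 1, by omega⟩
  obtain ⟨p, c, hc, rfl⟩ := hb.exists_eq_mul_S rfl
  have hnm : (n : ℤ) - m = -k := by push_cast at h; linarith
  exact ⟨p, c, hnm ▸ hc.mem_comp, rfl⟩

theorem T_mul_mul_S_mem {k : ℕ} {e : B}
    (he : e ∈ sMul (rep.grading.comp k) (rep.grading.comp (-(k : ℤ)))) (q : Q) (p : P) :
    rep.T q * e * rep.S p ∈
      sMul (rep.grading.comp ((k + 1 : ℕ) : ℤ)) (rep.grading.comp (-((k + 1 : ℕ) : ℤ))) :=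
  mul_mul_mem_sMul
    (fun _ hx => rep.grading.mul_mem' (rep.T_mem q) hx (by push_cast; ring))
    (fun _ hy => rep.grading.mul_mem' hy (rep.S_mem p) (by push_cast; ring)) he

theorem exists_mul_T_mul_eq {k : ℕ} {e : B}
    (he : e ∈ sMul (rep.grading.comp k) (rep.grading.comp (-(k : ℤ))))
    (hex : ∀ x ∈ rep.grading.comp k, e * x = x) {Θ : Q → Q} (hΘ : Θ ∈ FPQ sys) :
    ∃ f ∈ sMul (rep.grading.comp ((k + 1 : ℕ) : ℤ)) (rep.grading.comp (-((k + 1 : ℕ) : ℤ))),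
      ∀ q, ∀ y ∈ rep.grading.comp k, f * (rep.T q * y) = rep.T (Θ q) * y := by
  induction hΘ using AddSubgroup.closure_induction with
  | mem Θ h =>
    obtain ⟨q₀, p₀, rfl⟩ := h
    refine ⟨_, rep.T_mul_mul_S_mem he q₀ p₀, fun q y hy => ?_⟩
    have hσ : e * (rep.σ (sys.psi p₀ q) * y) = rep.σ (sys.psi p₀ q) * y :=
      hex _ (rep.grading.mul_mem' (rep.σ_mem _) hy (zero_add _))
    rw [theta, rep.T_rsmul, mul_assoc, mul_assoc, mul_assoc, ← mul_assoc (rep.S p₀), ← rep.σ_psi,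
      hσ]
  | zero => exact ⟨0, zero_mem _, fun q y _ => by simp [rep.T_zero]⟩
  | add Θ Θ' _ _ h h' =>
    obtain ⟨f, hf, hf'⟩ := h
    obtain ⟨g, hg, hg'⟩ := h'
    exact ⟨f + g, add_mem hf hg, fun q y hy => by
      rw [add_mul, hf' q y hy, hg' q y hy, Pi.add_apply, rep.T_add, add_mul]⟩
  | neg Θ _ h =>
    obtain ⟨f, hf, hf'⟩ := h
    exact ⟨-f, neg_mem hf, fun q y hy => by
      rw [neg_mul, hf' q y hy, Pi.neg_apply, rep.T_neg, neg_mul]⟩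

theorem exists_mul_S_mul_eq {k : ℕ} {e : B}
    (he : e ∈ sMul (rep.grading.comp k) (rep.grading.comp (-(k : ℤ))))
    (hex : ∀ x ∈ rep.grading.comp (-(k : ℤ)), x * e = x) {Φ : P → P} (hΦ : Φ ∈ FQP sys) :
    ∃ f ∈ sMul (rep.grading.comp ((k + 1 : ℕ) : ℤ)) (rep.grading.comp (-((k + 1 : ℕ) : ℤ))),
      ∀ p, ∀ y ∈ rep.grading.comp (-(k : ℤ)), y * rep.S p * f = y * rep.S (Φ p) := by
  induction hΦ using AddSubgroup.closure_induction with
  | mem Φ h =>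
    obtain ⟨p₀, q₀, rfl⟩ := h
    refine ⟨_, rep.T_mul_mul_S_mem he q₀ p₀, fun p y hy => ?_⟩
    have hσ : y * rep.σ (sys.psi p q₀) * e = y * rep.σ (sys.psi p q₀) :=
      hex _ (rep.grading.mul_mem' hy (rep.σ_mem _) (add_zero _))
    rw [thetaOp, rep.S_lsmul, ← mul_assoc, ← mul_assoc, ← mul_assoc, mul_assoc y, ← rep.σ_psi, hσ]
  | zero => exact ⟨0, zero_mem _, fun q y _ => by simp [rep.S_zero]⟩
  | add Φ Φ' _ _ h h' =>
    obtain ⟨f, hf, hf'⟩ := h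
    obtain ⟨g, hg, hg'⟩ := h'
    exact ⟨f + g, add_mem hf hg, fun p y hy => by
      rw [mul_add, hf' p y hy, hg' p y hy, Pi.add_apply, rep.S_add, mul_add]⟩
  | neg Φ _ h =>
    obtain ⟨f, hf, hf'⟩ := h
    exact ⟨-f, neg_mem hf, fun p y hy => by
      rw [mul_neg, hf' p y hy, Pi.neg_apply, rep.S_neg, mul_neg]⟩

theorem sigma_one_mem_sMul : rep.σ 1 ∈ sMul (rep.grading.comp 0) (rep.grading.comp 0) := by
  have h := mul_mem_sMul (rep.σ_mem 1) (rep.σ_mem 1)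
  rwa [← rep.σ_mul, one_mul] at h

theorem exists_left_unit (hu : sys.IsUnital) (hfs : (id : Q → Q) ∈ FPQ sys) (k : ℕ) :
    ∃ e ∈ sMul (rep.grading.comp k) (rep.grading.comp (-(k : ℤ))),
      ∀ x ∈ rep.grading.comp k, e * x = x := by
  induction k with
  | zero =>
    exact ⟨rep.σ 1, by simpa using rep.sigma_one_mem_sMul, fun x _ => rep.sigma_one_mul hu x⟩
  | succ k ih =>
    obtain ⟨e, he, hex⟩ := ih
    obtain ⟨f, hf, hfT⟩ := rep.exists_mul_T_mul_eq he hex hfs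
    refine ⟨f, hf, fun x hx => ?_⟩
    have hx' := rep.comp_succ_le hu k hx
    clear hx
    induction hx' using AddSubgroup.closure_induction with
    | mem x hx =>
      obtain ⟨q, y, hy, rfl⟩ := hx
      exact hfT q y hy
    | zero => simp
    | add x y _ _ hx hy => rw [mul_add, hx, hy]
    | neg x _ hx => rw [mul_neg, hx]

theorem exists_right_unit (hu : sys.IsUnital) (hfs : (id : P → P) ∈ FQP sys) (k : ℕ) :
    ∃ e ∈ sMul (rep.grading.comp k) (rep.grading.comp (-(k : ℤ))),
      ∀ x ∈ rep.grading.comp (-(k : ℤ)), x * e = x := by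
  induction k with
  | zero =>
    exact ⟨rep.σ 1, by simpa using rep.sigma_one_mem_sMul, fun x _ => rep.mul_sigma_one hu x⟩
  | succ k ih =>
    obtain ⟨e, he, hex⟩ := ih
    obtain ⟨f, hf, hfS⟩ := rep.exists_mul_S_mul_eq he hex hfs
    refine ⟨f, hf, fun x hx => ?_⟩
    have hx' := rep.comp_neg_succ_le hu k hx
    clear hx
    induction hx' using AddSubgroup.closure_induction with
    | mem x hx =>
      obtain ⟨p, y, hy, rfl⟩ := hx
      exact hfS p y hy
    | zero => simp
    | add x y _ _ hx hy => rw [add_mul, hx, hy]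
    | neg x _ hx => rw [neg_mul, hx]

end GradedCovRep

end Representation

/-- Let `R` be a unital ring, `(P,Q,ψ)` a unital `R`-system satisfying
Condition (FS'), and `(S,T,σ,B)` a semi-full graded covariant representation such that each
ideal `I^(k)` of `B₀` has a multiplicative identity element. Then `B` is epsilon-strongly
ℤ-graded. -/
theorem epsilon_strong_of_semiFull
    {R P Q B : Type*} [Ring R] [AddCommGroup P] [AddCommGroup Q] [NonUnitalRing B]
    (sys : RSystem R P Q) (hu : sys.IsUnital) (hfs : CondFS' sys)
    (rep : GradedCovRep sys B) (hsf : SemiFull rep)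
    (hI : ∀ k : ℕ, ∃ u ∈ idealI rep k, ∀ x ∈ idealI rep k, u * x = x ∧ x * u = x) :
    ∀ i : ℤ, ∃ ε ∈ sMul (rep.grading.comp i) (rep.grading.comp (-i)),
      ∃ ε' ∈ sMul (rep.grading.comp (-i)) (rep.grading.comp i),
        ∀ x ∈ rep.grading.comp i, ε * x = x ∧ x * ε' = x := by
  intro i
  obtain ⟨k, rfl | rfl⟩ := i.eq_nat_or_neg
  all_goals
    obtain ⟨u, hu_mem, hu_unit⟩ := hI k
    rw [← hsf k] at hu_mem hu_unit
  · obtain ⟨e, he, hex⟩ := rep.exists_left_unit hu hfs.1 k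
    exact ⟨e, he, u, hu_mem, fun x hx => ⟨hex x hx, mul_eq_self_of_left_unit he (hex x hx)
      fun y hy => (hu_unit _ (mul_mem_sMul hy hx)).2⟩⟩
  · obtain ⟨e, he, hex⟩ := rep.exists_right_unit hu hfs.2 k
    rw [neg_neg]
    exact ⟨u, hu_mem, e, he, fun x hx => ⟨mul_eq_self_of_right_unit he (hex x hx)
      fun y hy => (hu_unit _ (mul_mem_sMul hx hy)).1, hex x hx⟩⟩
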